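/- Let (a_n) be any digit sequence with values in {0,…,s−1}, let n ≥ 1, and let α, β be digit sequences with α_i = β_i for all i = 1,…,n−1. Then |Δ((|a_k − α_k|)_{k≥1}) − Δ((|a_k − β_k|)_{k≥1})| ≤ Π_{i=1}^{n−1} q_{|a_i − α_i|, i}. In particular this difference is at most Π_{i=1}^{n−1} max_j q_{j,i}. -/

import Mathlib

open Filter Topology MeasureTheory Set

set_option linter.unusedVariables false

/-- β_{k,n} = Σ_{i<k} q_{i,n}. -/
noncomputable def qbeta (s : ℕ) (q : Fin s → ℕ → ℝ) (k : Fin s) (n : ℕ) : ℝ :=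
  ∑ i : Fin s, if i < k then q i n else 0

/-- Δ(α) = β_{α_1,1} + Σ_{n≥2} β_{α_n,n} Π_{j<n} q_{α_j,j}, with positions indexed from 0. -/
noncomputable def Delta (s : ℕ) (q : Fin s → ℕ → ℝ) (α : ℕ → Fin s) : ℝ :=
  ∑' n : ℕ, qbeta s q (α n) n * ∏ j ∈ Finset.range n, q (α j) j

/-- the digit |a − b|. -/
def adiff {s : ℕ} (a b : Fin s) : Fin s :=
  ⟨a.1 - b.1 + (b.1 - a.1), by have ha := a.2; have hb := b.2; omega⟩

lemma qbeta_nonneg {s : ℕ} {q : Fin s → ℕ → ℝ} (hq0 : ∀ i n, 0 < q i n) (k : Fin s) (n : ℕ) :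
    0 ≤ qbeta s q k n := by
  refine Finset.sum_nonneg fun i _ => ?_
  split_ifs
  exacts [(hq0 i n).le, le_rfl]

lemma qbeta_add_le_one {s : ℕ} {q : Fin s → ℕ → ℝ} (hq0 : ∀ i n, 0 < q i n)
    (hqsum : ∀ n, ∑ i : Fin s, q i n = 1) (k : Fin s) (n : ℕ) :
    qbeta s q k n + q k n ≤ 1 := by
  have hk : q k n = ∑ i : Fin s, if i = k then q i n else 0 := by simp
  rw [← hqsum n, qbeta, hk, ← Finset.sum_add_distrib]
  refine Finset.sum_le_sum fun i _ => ?_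
  have := hq0 i n
  rcases lt_trichotomy i k with h | h | h
  · simp [h, h.ne]
  · simp [h]
  · simp [h.ne', h.not_gt, this.le]

/-- `Delta` lies in the cylinder interval determined by the first `n` digits. -/
lemma Delta_mem_Icc {s : ℕ} {q : Fin s → ℕ → ℝ} (hq0 : ∀ i n, 0 < q i n)
    (hqsum : ∀ n, ∑ i : Fin s, q i n = 1) (γ : ℕ → Fin s) (n : ℕ) :
    Delta s q γ ∈ Icc
      (∑ m ∈ Finset.range n, qbeta s q (γ m) m * ∏ j ∈ Finset.range m, q (γ j) j)
      (∑ m ∈ Finset.range n, qbeta s q (γ m) m * ∏ j ∈ Finset.range m, q (γ j) j +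
        ∏ j ∈ Finset.range n, q (γ j) j) := by
  set P : ℕ → ℝ := fun m => ∏ j ∈ Finset.range m, q (γ j) j with hP
  set f : ℕ → ℝ := fun m => qbeta s q (γ m) m * P m with hf
  have hP0 : ∀ m, 0 ≤ P m := fun m => Finset.prod_nonneg fun j _ => (hq0 _ _).le
  have hf0 : ∀ m, 0 ≤ f m := fun m => mul_nonneg (qbeta_nonneg hq0 _ _) (hP0 m)
  have hanti : Antitone fun m => ∑ i ∈ Finset.range m, f i + P m := by
    refine antitone_nat_of_succ_le fun m => ?_
    have hPs : P (m + 1) = P m * q (γ m) m := Finset.prod_range_succ _ _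
    have := mul_le_mul_of_nonneg_right (qbeta_add_le_one hq0 hqsum (γ m) m) (hP0 m)
    simp only [Finset.sum_range_succ, hPs, hf]
    linarith
  have hsum : Summable f := by
    refine summable_of_sum_range_le (c := 1) hf0 fun m => ?_
    have h := hanti (Nat.zero_le m)
    simp only [Finset.sum_range_zero, zero_add] at h
    have h1 : P 0 = 1 := by simp [hP]
    linarith [hP0 m]
  refine ⟨hsum.sum_le_tsum _ fun i _ => hf0 i, ?_⟩
  refine le_of_tendsto hsum.hasSum.tendsto_sum_nat ?_
  filter_upwards [eventually_ge_atTop n] with N hN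
  have h := hanti hN
  simp only at h
  change _ ≤ ∑ m ∈ Finset.range n, f m + P n
  linarith [hP0 N]

/-- if α and β agree in the first n digits, then
|Δ((|a_k − α_k|)) − Δ((|a_k − β_k|))| ≤ Π_{i<n} q_{|a_i−α_i|,i} ≤ Π_{i<n} max_j q_{j,i}. -/
theorem stmt8 (s : ℕ) (hs : 2 ≤ s) (q : Fin s → ℕ → ℝ)
    (hq0 : ∀ i n, 0 < q i n) (hq1 : ∀ i n, q i n < 1)
    (hqsum : ∀ n, ∑ i : Fin s, q i n = 1)
    (hqprod : Filter.Tendsto (fun N => ∏ n ∈ Finset.range N, ⨆ i : Fin s, q i n)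
      Filter.atTop (nhds 0))
    (a α β : ℕ → Fin s) (n : ℕ) (hagree : ∀ i < n, α i = β i) :
    |Delta s q (fun k => adiff (a k) (α k)) - Delta s q (fun k => adiff (a k) (β k))| ≤
        ∏ i ∈ Finset.range n, q (adiff (a i) (α i)) i ∧
      |Delta s q (fun k => adiff (a k) (α k)) - Delta s q (fun k => adiff (a k) (β k))| ≤
        ∏ i ∈ Finset.range n, ⨆ j : Fin s, q j i := by
  have key : |Delta s q (fun k => adiff (a k) (α k)) - Delta s q (fun k => adiff (a k) (β k))| ≤
      ∏ i ∈ Finset.range n, q (adiff (a i) (α i)) i := by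
    have hα := Delta_mem_Icc hq0 hqsum (fun k => adiff (a k) (α k)) n
    have hβ := Delta_mem_Icc hq0 hqsum (fun k => adiff (a k) (β k)) n
    have hprod : ∀ m ≤ n, ∏ j ∈ Finset.range m, q (adiff (a j) (β j)) j =
        ∏ j ∈ Finset.range m, q (adiff (a j) (α j)) j := fun m hm =>
      Finset.prod_congr rfl fun j hj => by
        rw [hagree j ((Finset.mem_range.1 hj).trans_le hm)]
    have hsum : ∑ m ∈ Finset.range n, qbeta s q (adiff (a m) (β m)) m *
          ∏ j ∈ Finset.range m, q (adiff (a j) (β j)) j =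
        ∑ m ∈ Finset.range n, qbeta s q (adiff (a m) (α m)) m *
          ∏ j ∈ Finset.range m, q (adiff (a j) (α j)) j :=
      Finset.sum_congr rfl fun m hm => by
        have hm := Finset.mem_range.1 hm
        rw [hprod m hm.le, hagree m hm]
    rw [hprod n le_rfl, hsum] at hβ
    rw [abs_le]
    constructor <;> linarith [hα.1, hα.2, hβ.1, hβ.2]
  exact ⟨key, key.trans <| Finset.prod_le_prod (fun i _ => (hq0 _ _).le) fun i _ =>
    le_ciSup (f := fun j => q j i) (finite_range _).bddAbove _⟩
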